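/- Let M, N be finite POVMs on ℂ^d such that S_M(ρ) = S_N(ρ) for every density matrix ρ. Then for every trace-one positive operator μ, the total volume of elements of M proportional to μ equals the total volume of elements of N proportional to μ: Σ_{i : M_i/tr(M_i) = μ} tr(M_i) = Σ_{j : N_j/tr(N_j) = μ} tr(N_j). Consequently M and N are stochastic post-processings of each other. -/

import Mathlib

open Matrix BigOperators
open scoped Classical ComplexOrder

/-- A (finitely indexed) POVM on `ℂ^d`: positive semidefinite elements summing to the identity. -/
def IsPOVM {d : ℕ} {ι : Type*} [Fintype ι] (M : ι → Matrix (Fin d) (Fin d) ℂ) : Prop :=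
  (∀ i, (M i).PosSemidef) ∧ ∑ i, M i = 1

/-- A density matrix: positive semidefinite with unit trace. -/
def IsDensity {d : ℕ} (ρ : Matrix (Fin d) (Fin d) ℂ) : Prop :=
  ρ.PosSemidef ∧ ρ.trace = 1

/-- Outcome probability `tr(M_i ρ)` (real part). -/
noncomputable def prob {d : ℕ} {ι : Type*} [Fintype ι] (M : ι → Matrix (Fin d) (Fin d) ℂ)
    (ρ : Matrix (Fin d) (Fin d) ℂ) (i : ι) : ℝ := ((M i * ρ).trace).re

/-- Measured relative entropy `D_M(ρ‖σ) = Σ_i p_i log (p_i / q_i)`. -/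
noncomputable def Dmeas {d : ℕ} {ι : Type*} [Fintype ι] (M : ι → Matrix (Fin d) (Fin d) ℂ)
    (ρ σ : Matrix (Fin d) (Fin d) ℂ) : ℝ :=
  ∑ i, prob M ρ i * Real.log (prob M ρ i / prob M σ i)

/-- Observational entropy `S_M(ρ) = -Σ_i p_i log (p_i / V_i)` with `V_i = tr M_i`. -/
noncomputable def Sobs {d : ℕ} {ι : Type*} [Fintype ι] (M : ι → Matrix (Fin d) (Fin d) ℂ)
    (ρ : Matrix (Fin d) (Fin d) ℂ) : ℝ :=
  -∑ i, prob M ρ i * Real.log (prob M ρ i / ((M i).trace).re)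

/-- `N` is a stochastic post-processing of `M` (`N ≫ M`). -/
def StochPost {d : ℕ} {ι κ : Type*} [Fintype ι] [Fintype κ]
    (N : κ → Matrix (Fin d) (Fin d) ℂ) (M : ι → Matrix (Fin d) (Fin d) ℂ) : Prop :=
  ∃ Λ : κ → ι → ℝ, (∀ j i, 0 ≤ Λ j i) ∧ (∀ i, ∑ j, Λ j i = 1) ∧
    ∀ j, N j = ∑ i, Λ j i • M i

open Filter Topology

/-- If a function vanishes near `0`, so does its derivative. -/
lemma aux_deriv_zero {F G : ℝ → ℝ} (hF : ∀ᶠ t : ℝ in 𝓝 (0 : ℝ), F t = 0)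
    (hG : ∀ᶠ t : ℝ in 𝓝 (0 : ℝ), HasDerivAt F (G t) t) : ∀ᶠ t in 𝓝 (0 : ℝ), G t = 0 := by
  filter_upwards [hF.eventually_nhds, hG] with t h1 h2
  have h3 : F =ᶠ[𝓝 t] fun _ => (0 : ℝ) := h1
  exact h2.unique ((hasDerivAt_const t (0 : ℝ)).congr_of_eventuallyEq h3)

lemma aux_pos {α : Type*} [Fintype α] (z : α → ℝ) :
    ∀ᶠ t : ℝ in 𝓝 (0 : ℝ), ∀ a, 0 < 1 + t * z a := by
  rw [Filter.eventually_all]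
  intro a
  have hc : ContinuousAt (fun t : ℝ => 1 + t * z a) 0 := by fun_prop
  exact hc.eventually (lt_mem_nhds (by simp))

lemma aux_moments {α : Type*} [Fintype α] (c z : α → ℝ)
    (h : ∀ᶠ t : ℝ in 𝓝 (0 : ℝ), ∑ a, c a * ((1 + t * z a) * Real.log (1 + t * z a)) = 0)
    (h0 : ∑ a, c a = 0) (h1 : ∑ a, c a * z a = 0) (k : ℕ) : ∑ a, c a * z a ^ k = 0 := by
  have hp := aux_pos z
  have hlin : ∀ a t, HasDerivAt (fun t : ℝ => 1 + t * z a) (z a) t := fun a t => by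
    simpa using ((hasDerivAt_id t).mul_const (z a)).const_add 1
  have d1 : ∀ᶠ t : ℝ in 𝓝 (0 : ℝ), ∑ a, c a * (z a * Real.log (1 + t * z a) + z a) = 0 := by
    refine aux_deriv_zero h ?_
    filter_upwards [hp] with t ht
    refine HasDerivAt.fun_sum fun a _ => ?_
    refine HasDerivAt.const_mul _ ?_
    have h3 := (hlin a t).fun_mul ((hlin a t).log (ht a).ne')
    rwa [mul_div_cancel₀ _ (ht a).ne'] at h3
  have d2 : ∀ k : ℕ, ∀ᶠ t : ℝ in 𝓝 (0 : ℝ), ∑ a, c a * (z a ^ (k+2) * ((1 + t * z a) ^ (k+1))⁻¹) = 0 := by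
    intro k
    induction k with
    | zero =>
      refine aux_deriv_zero d1 ?_
      filter_upwards [hp] with t ht
      refine HasDerivAt.fun_sum fun a _ => ?_
      refine HasDerivAt.const_mul _ ?_
      have h3 := (((hlin a t).log (ht a).ne').const_mul (z a)).add_const (z a)
      have h4 : z a ^ (0 + 2) * ((1 + t * z a) ^ (0 + 1))⁻¹ = z a * (z a / (1 + t * z a)) := by
        ring
      rwa [h4]
    | succ k ih =>
      have := aux_deriv_zero (G := fun t => -(k+1 : ℝ) *
          ∑ a, c a * (z a ^ (k+1+2) * ((1 + t * z a) ^ (k+1+1))⁻¹)) ih ?_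
      · filter_upwards [this] with t ht
        have hk : -(k+1 : ℝ) ≠ 0 := by
          have : (0:ℝ) < k + 1 := by positivity
          linarith
        exact (mul_eq_zero.1 ht).resolve_left hk
      · filter_upwards [hp] with t ht
        rw [Finset.mul_sum]
        refine HasDerivAt.fun_sum fun a _ => ?_
        have h3 := (((((hlin a t).fun_pow (k+1)).fun_inv (pow_ne_zero _ (ht a).ne')).const_mul
          (z a ^ (k+2))).const_mul (c a))
        refine h3.congr_deriv ?_
        have := (ht a).ne'
        push_cast
        field_simp
        simp
        ring
  match k with
  | 0 => simpa using h0
  | 1 => simpa using h1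
  | k + 2 => simpa using (d2 k).self_of_nhds

lemma aux_level {α : Type*} [Fintype α] (c z : α → ℝ)
    (h : ∀ k : ℕ, ∑ a, c a * z a ^ k = 0) (z0 : ℝ) :
    ∑ a, (if z a = z0 then c a else 0) = 0 := by
  have hP : ∀ P : Polynomial ℝ, ∑ a, c a * P.eval (z a) = 0 := by
    intro P
    simp only [Polynomial.eval_eq_sum_range, Finset.mul_sum]
    rw [Finset.sum_comm]
    refine Finset.sum_eq_zero fun k _ => ?_
    have := congrArg (fun r => P.coeff k * r) (h k)
    simp only [Finset.mul_sum, mul_zero] at this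
    rw [← this]
    exact Finset.sum_congr rfl fun a _ => by ring
  let P : Polynomial ℝ := ∏ w ∈ (Finset.univ.image z).erase z0, (Polynomial.X - Polynomial.C w)
  have h0 : P.eval z0 ≠ 0 := by
    simp only [P, Polynomial.eval_prod]
    refine Finset.prod_ne_zero_iff.2 fun w hw => ?_
    simpa [sub_eq_zero] using (Finset.ne_of_mem_erase hw).symm
  have h1 : ∀ a, z a ≠ z0 → P.eval (z a) = 0 := by
    intro a ha
    simp only [P, Polynomial.eval_prod]
    exact Finset.prod_eq_zero (i := z a) (by simp [ha]) (by simp)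
  have h2 := hP P
  have h3 : ∑ a, c a * P.eval (z a) = (∑ a, (if z a = z0 then c a else 0)) * P.eval z0 := by
    rw [Finset.sum_mul]
    refine Finset.sum_congr rfl fun a _ => ?_
    by_cases ha : z a = z0
    · simp [ha]
    · simp [ha, h1 a ha]
  rw [h3] at h2
  exact (mul_eq_zero.1 h2).resolve_right h0

lemma aux_psd {d : ℕ} (X : Matrix (Fin d) (Fin d) ℂ) (hX : X.IsHermitian) :
    ∀ᶠ t : ℝ in 𝓝 (0 : ℝ), (1 + (t : ℂ) • X).PosSemidef := by
  open scoped Matrix.Norms.L2Operator MatrixOrder in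
  have hs : IsSelfAdjoint X := hX
  obtain ⟨C, hC0, hC1, hC2⟩ : ∃ C : ℝ, 0 ≤ C ∧ ((C : ℂ) • (1 : Matrix (Fin d) (Fin d) ℂ) - X).PosSemidef ∧
      ((C : ℂ) • (1 : Matrix (Fin d) (Fin d) ℂ) + X).PosSemidef := by
    open scoped Matrix.Norms.L2Operator MatrixOrder in
    have h1 := hs.le_algebraMap_norm_self
    have h2 := hs.neg_algebraMap_norm_le_self
    refine ⟨‖X‖, norm_nonneg _, ?_, ?_⟩
    · rw [Matrix.le_iff, Algebra.algebraMap_eq_smul_one] at h1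
      simpa using h1
    · rw [Matrix.le_iff, Algebra.algebraMap_eq_smul_one] at h2
      simpa [add_comm] using h2
  have hc : ContinuousAt (fun t : ℝ => |t| * C) 0 := by fun_prop
  have : ∀ᶠ t : ℝ in 𝓝 (0 : ℝ), |t| * C < 1 := 
    hc.tendsto.eventually_lt_const (by simp)
  filter_upwards [this] with t ht
  have e1 : ((1 - |t| * C : ℝ) : ℂ) • (1 : Matrix (Fin d) (Fin d) ℂ) |>.PosSemidef :=
    Matrix.PosSemidef.one.smul (by exact_mod_cast (by linarith : (0:ℝ) ≤ 1 - |t| * C))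
  have hta : (0 : ℂ) ≤ ((|t| : ℝ) : ℂ) := by exact_mod_cast abs_nonneg t
  rcases le_total 0 t with h0 | h0
  · have := e1.add (hC2.smul hta)
    convert this using 1
    rw [abs_of_nonneg h0]
    push_cast
    module
  · have := e1.add (hC1.smul hta)
    convert this using 1
    rw [abs_of_nonpos h0]
    push_cast
    module

lemma aux_trace_sq {d : ℕ} {D : Matrix (Fin d) (Fin d) ℂ} (hD : D.IsHermitian) (h0 : D ≠ 0) :
    ((D * D).trace).re ≠ 0 := by
  intro h
  have h1 : (Dᴴ * D).PosSemidef := Matrix.posSemidef_conjTranspose_mul_self D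
  rw [hD.eq] at h1
  have h2 := h1.trace_nonneg
  rw [Complex.le_def] at h2
  have h3 : (D * D).trace = 0 := Complex.ext h h2.2.symm
  have h4 : (Dᴴ * D).trace = 0 := by rw [hD.eq]; exact h3
  exact h0 (Matrix.trace_conjTranspose_mul_self_eq_zero_iff.1 h4)

lemma aux_generic {d : ℕ} (s : Finset (Matrix (Fin d) (Fin d) ℂ))
    (hs : ∀ D ∈ s, D.IsHermitian ∧ D.trace = 0 ∧ D ≠ 0) :
    ∃ X : Matrix (Fin d) (Fin d) ℂ, X.IsHermitian ∧ X.trace = 0 ∧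
      ∀ D ∈ s, ((D * X).trace).re ≠ 0 := by
  induction s using Finset.induction_on with
  | empty => exact ⟨0, by simp, by simp, by simp⟩
  | insert D s hDs ih =>
    obtain ⟨X, hX1, hX2, hX3⟩ := ih fun D hD => hs D (Finset.mem_insert_of_mem hD)
    obtain ⟨hD1, hD2, hD3⟩ := hs D (Finset.mem_insert_self _ _)
    by_cases hDX : ((D * X).trace).re = 0
    · have ev : ∀ᶠ t : ℝ in 𝓝 (0 : ℝ), ∀ E ∈ s,
          ((E * X).trace).re + t * ((E * D).trace).re ≠ 0 := by
        rw [Filter.eventually_all_finset]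
        intro E hE
        have hc : ContinuousAt (fun t : ℝ => ((E * X).trace).re + t * ((E * D).trace).re) 0 := by
          fun_prop
        exact hc.eventually_ne (by simpa using hX3 E hE)
      obtain ⟨t, ht1, ht2⟩ := ((ev.filter_mono nhdsWithin_le_nhds).and
        (self_mem_nhdsWithin : ∀ᶠ t in 𝓝[≠] (0 : ℝ), t ∈ ({0}ᶜ : Set ℝ))).exists
      have key : ∀ E : Matrix (Fin d) (Fin d) ℂ, ((E * (X + t • D)).trace).re
          = ((E * X).trace).re + t * ((E * D).trace).re := by
        intro E
        simp [mul_add, Matrix.trace_add, Matrix.trace_smul]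
      refine ⟨X + t • D, hX1.add ?_, ?_, ?_⟩
      · unfold Matrix.IsHermitian
        rw [Matrix.conjTranspose_smul, hD1.eq]; simp
      · simp [Matrix.trace_add, Matrix.trace_smul, hX2, hD2]
      · intro E hE
        rw [key]
        rcases Finset.mem_insert.1 hE with rfl | hE
        · rw [hDX, zero_add]
          exact mul_ne_zero ht2 (aux_trace_sq hD1 hD3)
        · exact ht1 E hE
    · refine ⟨X, hX1, hX2, fun E hE => ?_⟩
      rcases Finset.mem_insert.1 hE with rfl | hE
      · exact hDX
      · exact hX3 E hE

lemma aux_tr {d : ℕ} {A : Matrix (Fin d) (Fin d) ℂ} (hA : A.PosSemidef) :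
    A.trace = ((A.trace.re : ℝ) : ℂ) ∧ 0 ≤ A.trace.re ∧ (A.trace.re = 0 → A = 0) := by
  have h := hA.trace_nonneg
  rw [Complex.le_def] at h
  have e : A.trace = ((A.trace.re : ℝ) : ℂ) := Complex.ext (by simp) (by simpa using h.2.symm)
  refine ⟨e, h.1, fun h0 => hA.trace_eq_zero_iff.1 ?_⟩
  rw [e, h0]; simp

/-- The normalised pairing `tr (M_i X) / tr M_i`. -/
noncomputable def auxX {d : ℕ} (A X : Matrix (Fin d) (Fin d) ℂ) : ℝ :=
  ((A * X).trace).re / A.trace.re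

lemma aux_V_mul {d : ℕ} {A : Matrix (Fin d) (Fin d) ℂ} (hA : A.PosSemidef)
    (X : Matrix (Fin d) (Fin d) ℂ) : A.trace.re * auxX A X = ((A * X).trace).re := by
  unfold auxX
  by_cases h0 : A.trace.re = 0
  · have := (aux_tr hA).2.2 h0
    subst this; simp
  · field_simp

lemma aux_sumV {d : ℕ} {ι : Type*} [Fintype ι] {M : ι → Matrix (Fin d) (Fin d) ℂ}
    (hM : IsPOVM M) : ∑ i, (M i).trace.re = d := by
  rw [← Complex.re_sum, ← Matrix.trace_sum, hM.2]; simp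

lemma aux_sumVx {d : ℕ} {ι : Type*} [Fintype ι] {M : ι → Matrix (Fin d) (Fin d) ℂ}
    (hM : IsPOVM M) {X : Matrix (Fin d) (Fin d) ℂ} (hX : X.trace = 0) :
    ∑ i, (M i).trace.re * auxX (M i) X = 0 := by
  simp only [aux_V_mul (hM.1 _)]
  rw [← Complex.re_sum, ← Matrix.trace_sum, ← Finset.sum_mul, hM.2]; simp [hX]

lemma aux_Sobs {d : ℕ} (hd : 0 < d) {ι : Type*} [Fintype ι] {M : ι → Matrix (Fin d) (Fin d) ℂ}
    (hM : IsPOVM M) {X : Matrix (Fin d) (Fin d) ℂ} (hX : X.trace = 0) :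
    ∀ᶠ t : ℝ in 𝓝 (0 : ℝ), Sobs M ((d : ℂ)⁻¹ • (1 + (t : ℂ) • X)) = Real.log d -
      (d : ℝ)⁻¹ * ∑ i, (M i).trace.re *
        ((1 + t * auxX (M i) X) * Real.log (1 + t * auxX (M i) X)) := by
  filter_upwards [aux_pos fun i => auxX (M i) X] with t ht
  have hd' : (0 : ℝ) < d := by exact_mod_cast hd
  have hprob : ∀ i, prob M ((d : ℂ)⁻¹ • (1 + (t : ℂ) • X)) i
      = (M i).trace.re * ((1 + t * auxX (M i) X) / d) := by
    intro i
    have e : (M i).trace.re * ((1 + t * auxX (M i) X) / d)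
        = (d : ℝ)⁻¹ * ((M i).trace.re + t * ((M i).trace.re * auxX (M i) X)) := by
      field_simp
    rw [e, aux_V_mul (hM.1 i)]
    unfold prob
    have e2 : ((M i) * ((d : ℂ)⁻¹ • (1 + (t : ℂ) • X))).trace
        = (((d : ℝ)⁻¹ : ℝ) : ℂ) * ((M i).trace + (t : ℂ) * ((M i) * X).trace) := by
      simp [mul_add, Matrix.trace_add, Matrix.trace_smul]
    rw [e2, Complex.re_ofReal_mul, Complex.add_re, Complex.re_ofReal_mul]
  have hterm : ∀ i, prob M ((d : ℂ)⁻¹ • (1 + (t : ℂ) • X)) i *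
      Real.log (prob M ((d : ℂ)⁻¹ • (1 + (t : ℂ) • X)) i / ((M i).trace).re)
      = (d : ℝ)⁻¹ * ((M i).trace.re *
        ((1 + t * auxX (M i) X) * Real.log (1 + t * auxX (M i) X)))
        - (d : ℝ)⁻¹ * Real.log d * (M i).trace.re
        - (d : ℝ)⁻¹ * Real.log d * t * ((M i).trace.re * auxX (M i) X) := by
    intro i
    rw [hprob]
    by_cases h0 : (M i).trace.re = 0
    · simp [h0]
    · rw [mul_div_cancel_left₀ _ h0, Real.log_div (ht i).ne' hd'.ne']
      ring
  unfold Sobs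
  rw [Finset.sum_congr rfl fun i _ => hterm i, Finset.sum_sub_distrib, Finset.sum_sub_distrib,
    ← Finset.mul_sum, ← Finset.mul_sum, ← Finset.mul_sum, aux_sumV hM, aux_sumVx hM hX]
  field_simp
  ring

lemma aux_volume {d m n : ℕ} (hd : 0 < d) (M : Fin m → Matrix (Fin d) (Fin d) ℂ)
    (N : Fin n → Matrix (Fin d) (Fin d) ℂ) (hM : IsPOVM M) (hN : IsPOVM N)
    (h : ∀ ρ : Matrix (Fin d) (Fin d) ℂ, IsDensity ρ → Sobs M ρ = Sobs N ρ)
    (μ : Matrix (Fin d) (Fin d) ℂ) (hμ : μ.PosSemidef) (hμ1 : μ.trace = 1) :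
      ∑ i ∈ Finset.univ.filter
          (fun i => (M i).trace ≠ 0 ∧ ((M i).trace)⁻¹ • M i = μ), ((M i).trace).re
        = ∑ j ∈ Finset.univ.filter
          (fun j => (N j).trace ≠ 0 ∧ ((N j).trace)⁻¹ • N j = μ), ((N j).trace).re := by
  have hd' : (0 : ℝ) < d := by exact_mod_cast hd
  let L : Fin m ⊕ Fin n → Matrix (Fin d) (Fin d) ℂ := Sum.elim M N
  have hL : ∀ a, (L a).PosSemidef := by
    rintro (i | j)
    · exact hM.1 i
    · exact hN.1 j
  let nu : Fin m ⊕ Fin n → Matrix (Fin d) (Fin d) ℂ := fun a => ((L a).trace)⁻¹ • L a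
  obtain ⟨X, hX1, hX2, hX3⟩ := aux_generic
    ((Finset.univ.filter fun a => (L a).trace ≠ 0 ∧ nu a ≠ μ).image fun a => nu a - μ) (by
      intro D hD
      obtain ⟨a, ha, rfl⟩ := Finset.mem_image.1 hD
      obtain ⟨ha1, ha2⟩ := (Finset.mem_filter.1 ha).2
      refine ⟨Matrix.IsHermitian.sub ?_ hμ.1, ?_, sub_ne_zero.2 ha2⟩
      · unfold Matrix.IsHermitian
        simp only [nu]
        rw [Matrix.conjTranspose_smul, (hL a).1.eq, (aux_tr (hL a)).1]
        simp
      · simp only [nu, Matrix.trace_sub, Matrix.trace_smul, hμ1, smul_eq_mul]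
        rw [inv_mul_cancel₀ ha1, sub_self])
  have hsep : ∀ a, (L a).trace ≠ 0 → (auxX (L a) X = ((μ * X).trace).re ↔ nu a = μ) := by
    intro a ha
    have e : auxX (L a) X = ((nu a * X).trace).re := by
      simp only [nu, auxX]
      rw [Matrix.smul_mul, Matrix.trace_smul, smul_eq_mul, (aux_tr (hL a)).1, ← Complex.ofReal_inv,
        Complex.re_ofReal_mul, Complex.ofReal_re]
      ring
    rw [e]
    constructor
    · intro h1
      by_contra h2
      refine hX3 (nu a - μ) (Finset.mem_image_of_mem _ (by simp [ha, h2])) ?_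
      rw [sub_mul, Matrix.trace_sub, Complex.sub_re, h1, sub_self]
    · intro h1; rw [h1]
  let c : Fin m ⊕ Fin n → ℝ := Sum.elim (fun i => (M i).trace.re) (fun j => -(N j).trace.re)
  let z : Fin m ⊕ Fin n → ℝ := fun a => auxX (L a) X
  have hmom := aux_moments c z (by
      filter_upwards [aux_Sobs hd hM hX2, aux_Sobs hd hN hX2, aux_psd X hX1] with t h1 h2 h3
      have h4 := h ((d : ℂ)⁻¹ • (1 + (t : ℂ) • X)) ⟨h3.smul (by
          rw [← Complex.ofReal_natCast, ← Complex.ofReal_inv]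
          exact_mod_cast (inv_nonneg.2 hd'.le)), by
        have : (d : ℂ) ≠ 0 := by exact_mod_cast hd.ne'
        simp [Matrix.trace_add, Matrix.trace_smul, hX2, this]⟩
      rw [h1, h2] at h4
      have h5 := mul_left_cancel₀ (inv_ne_zero hd'.ne') (sub_right_injective h4)
      rw [Fintype.sum_sum_type]
      simp only [c, z, L, Sum.elim_inl, Sum.elim_inr, neg_mul, Finset.sum_neg_distrib]
      rw [h5]; ring)
    (by
      rw [Fintype.sum_sum_type]
      simp only [c, Sum.elim_inl, Sum.elim_inr, Finset.sum_neg_distrib]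
      rw [aux_sumV hM, aux_sumV hN]; ring)
    (by
      rw [Fintype.sum_sum_type]
      simp only [c, z, L, Sum.elim_inl, Sum.elim_inr, neg_mul, Finset.sum_neg_distrib]
      rw [aux_sumVx hM hX2, aux_sumVx hN hX2]; ring)
  have hlev := aux_level c z hmom ((μ * X).trace).re
  rw [Fintype.sum_sum_type] at hlev
  have eM : ∀ i, (if z (Sum.inl i) = ((μ * X).trace).re then c (Sum.inl i) else 0)
      = if (M i).trace ≠ 0 ∧ ((M i).trace)⁻¹ • M i = μ then ((M i).trace).re else 0 := by
    intro i
    by_cases h0 : (M i).trace = 0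
    · simp [c, h0]
    · have := hsep (Sum.inl i) h0
      simp only [L, nu, Sum.elim_inl] at this
      simp [c, z, L, h0, this]
  have eN : ∀ j, (if z (Sum.inr j) = ((μ * X).trace).re then c (Sum.inr j) else 0)
      = -(if (N j).trace ≠ 0 ∧ ((N j).trace)⁻¹ • N j = μ then ((N j).trace).re else 0) := by
    intro j
    by_cases h0 : (N j).trace = 0
    · simp [c, h0]
    · have := hsep (Sum.inr j) h0
      simp only [L, nu, Sum.elim_inr] at this
      simp only [c, z, L, Sum.elim_inr, this]
      split_ifs <;> simp_all
  simp only [eM, eN, Finset.sum_neg_distrib] at hlev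
  rw [Finset.sum_filter, Finset.sum_filter]
  linarith

lemma aux_post {d m n : ℕ} (hd : 0 < d) (M : Fin m → Matrix (Fin d) (Fin d) ℂ)
    (N : Fin n → Matrix (Fin d) (Fin d) ℂ) (hM : IsPOVM M) (hN : IsPOVM N)
    (h : ∀ μ : Matrix (Fin d) (Fin d) ℂ, μ.PosSemidef → μ.trace = 1 →
      ∑ i ∈ Finset.univ.filter
          (fun i => (M i).trace ≠ 0 ∧ ((M i).trace)⁻¹ • M i = μ), ((M i).trace).re
        = ∑ j ∈ Finset.univ.filter
          (fun j => (N j).trace ≠ 0 ∧ ((N j).trace)⁻¹ • N j = μ), ((N j).trace).re) :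
    StochPost M N := by
  have hm : 0 < m := by
    rcases Nat.eq_zero_or_pos m with rfl | hm
    · have := aux_sumV hM
      simp only [Finset.univ_eq_empty, Finset.sum_empty] at this
      exact absurd (by exact_mod_cast this.symm : d = 0) hd.ne'
    · exact hm
  have hm' : (0 : ℝ) < m := by exact_mod_cast hm
  let T : Matrix (Fin d) (Fin d) ℂ → ℝ := fun μ => ∑ i ∈ Finset.univ.filter
          (fun i => (M i).trace ≠ 0 ∧ ((M i).trace)⁻¹ • M i = μ), ((M i).trace).re
  have hT0 : ∀ μ, 0 ≤ T μ := fun μ => Finset.sum_nonneg fun i _ => (aux_tr (hM.1 i)).2.1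
  have hnorm : ∀ A : Matrix (Fin d) (Fin d) ℂ, A.PosSemidef → A.trace ≠ 0 →
      ((A.trace)⁻¹ • A).PosSemidef ∧ ((A.trace)⁻¹ • A).trace = 1 := by
    intro A hA h0
    refine ⟨hA.smul ?_, ?_⟩
    · rw [(aux_tr hA).1, ← Complex.ofReal_inv]
      exact_mod_cast inv_nonneg.2 (aux_tr hA).2.1
    · rw [Matrix.trace_smul, smul_eq_mul, inv_mul_cancel₀ h0]
  refine ⟨fun i j => if (N j).trace = 0 then (m : ℝ)⁻¹ else
    if (M i).trace ≠ 0 ∧ ((M i).trace)⁻¹ • M i = ((N j).trace)⁻¹ • N j then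
      (M i).trace.re / T (((N j).trace)⁻¹ • N j) else 0, ?_, ?_, ?_⟩
  · intro i j
    have := hT0 (((N j).trace)⁻¹ • N j)
    have := (aux_tr (hM.1 i)).2.1
    dsimp only
    split_ifs <;> positivity
  · intro j
    by_cases h0 : (N j).trace = 0
    · simp only [h0, if_true]
      simp [hm'.ne']
    · simp only [h0, if_false]
      rw [← Finset.sum_filter, ← Finset.sum_div]
      change T _ / T _ = 1
      refine div_self (ne_of_gt ?_)
      have hj := hnorm _ (hN.1 j) h0
      simp only [T]
      rw [h _ hj.1 hj.2]
      have hpos : 0 < (N j).trace.re := by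
        refine lt_of_le_of_ne (aux_tr (hN.1 j)).2.1 fun h1 => h0 ?_
        rw [(aux_tr (hN.1 j)).1, ← h1]; simp
      refine lt_of_lt_of_le hpos (Finset.single_le_sum (f := fun j => (N j).trace.re)
        (fun k _ => (aux_tr (hN.1 k)).2.1) (by simp [h0]))
  · intro i
    by_cases h0 : (M i).trace = 0
    · have hMi : M i = 0 := (hM.1 i).trace_eq_zero_iff.1 h0
      rw [hMi]
      symm
      refine Finset.sum_eq_zero fun j _ => ?_
      by_cases h1 : (N j).trace = 0
      · rw [(hN.1 j).trace_eq_zero_iff.1 h1]; simp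
      · beta_reduce
        rw [if_neg h1, if_neg (fun h => h.1 h0), zero_smul]
    · set μ := ((M i).trace)⁻¹ • M i with hμ
      have hi := hnorm _ (hM.1 i) h0
      have hTμ : T μ ≠ 0 := by
        have hpos : 0 < (M i).trace.re := by
          refine lt_of_le_of_ne (aux_tr (hM.1 i)).2.1 fun h1 => h0 ?_
          rw [(aux_tr (hM.1 i)).1, ← h1]; simp
        refine ne_of_gt (lt_of_lt_of_le hpos (Finset.single_le_sum (f := fun j => (M j).trace.re)
          (fun k _ => (aux_tr (hM.1 k)).2.1) (by simp [h0, μ])))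
      have hterm : ∀ j, (if (N j).trace = 0 then (m : ℝ)⁻¹ else
          if (M i).trace ≠ 0 ∧ μ = ((N j).trace)⁻¹ • N j then
          (M i).trace.re / T (((N j).trace)⁻¹ • N j) else 0) • N j
          = ((M i).trace.re / T μ * (if (N j).trace ≠ 0 ∧ ((N j).trace)⁻¹ • N j = μ then
            (N j).trace.re else 0)) • μ := by
        intro j
        by_cases h1 : (N j).trace = 0
        · rw [(hN.1 j).trace_eq_zero_iff.1 h1]; simp
        · by_cases h2 : μ = ((N j).trace)⁻¹ • N j
          · have h3 : N j = (N j).trace.re • μ := by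
              rw [h2, ← Complex.coe_smul, ← (aux_tr (hN.1 j)).1, smul_smul, mul_inv_cancel₀ h1,
                one_smul]
            rw [if_neg h1, if_pos ⟨h0, h2⟩, if_pos ⟨h1, h2.symm⟩, ← h2, mul_smul, ← h3]
          · rw [if_neg h1, if_neg (fun h => h2 h.2), if_neg (fun h => h2 h.2.symm)]
            simp
      rw [Finset.sum_congr rfl fun j _ => hterm j, ← Finset.sum_smul, ← Finset.mul_sum,
        ← Finset.sum_filter, ← h μ hi.1 hi.2]
      change _ = ((M i).trace.re / T μ * T μ) • μ
      rw [div_mul_cancel₀ _ hTμ, hμ, ← Complex.coe_smul, ← (aux_tr (hM.1 i)).1, smul_smul,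
        mul_inv_cancel₀ h0, one_smul]

theorem stmt19 {d m n : ℕ} (hd : 0 < d) (M : Fin m → Matrix (Fin d) (Fin d) ℂ)
    (N : Fin n → Matrix (Fin d) (Fin d) ℂ) (hM : IsPOVM M) (hN : IsPOVM N)
    (h : ∀ ρ : Matrix (Fin d) (Fin d) ℂ, IsDensity ρ → Sobs M ρ = Sobs N ρ) :
    (∀ μ : Matrix (Fin d) (Fin d) ℂ, μ.PosSemidef → μ.trace = 1 →
      ∑ i ∈ Finset.univ.filter
          (fun i => (M i).trace ≠ 0 ∧ ((M i).trace)⁻¹ • M i = μ), ((M i).trace).re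
        = ∑ j ∈ Finset.univ.filter
          (fun j => (N j).trace ≠ 0 ∧ ((N j).trace)⁻¹ • N j = μ), ((N j).trace).re)
    ∧ StochPost M N ∧ StochPost N M := by
  have hv := aux_volume hd M N hM hN h
  exact ⟨hv, aux_post hd M N hM hN hv,
    aux_post hd N M hN hM fun μ h1 h2 => (hv μ h1 h2).symm⟩
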